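/- (Sensitivity after rotation of two consecutive cores) Let A : Fin I₁ → Matrix (Fin R₁) (Fin R₂) ℝ, B : Fin I₂ → Matrix (Fin R₂) (Fin R₃) ℝ, C : Fin I₃ → Matrix (Fin R₃) (Fin R₁) ℝ be core families, and let Q : Matrix (Fin R₂) (Fin R₂) ℝ be invertible. Define T₁ = ∑_{j} (B j) * (∑_{k} (C k) * (C k)ᵀ) * (B j)ᵀ and T₂ = ∑_{i} (A i)ᵀ * (∑_{k} (C k)ᵀ * (C k)) * (A i), both R₂ × R₂ matrices. Then the sensitivity of the rotated representation ((fun i => A i * Q), (fun j => Q⁻¹ * B j), C) satisfies ss(A * Q, Q⁻¹ * B, C) = I₃ * ∑_{i,j} ‖A i * B j‖_F² + I₁ * Matrix.trace (T₁ * (Q * Qᵀ)⁻¹) + I₂ * Matrix.trace (T₂ * (Q * Qᵀ)). -/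

import Mathlib

open scoped BigOperators Matrix

/-- Squared Frobenius norm of a real matrix. -/
def matFrobSq {n m : ℕ} (M : Matrix (Fin n) (Fin m) ℝ) : ℝ :=
  ∑ i, ∑ j, (M i j) ^ 2

theorem matFrobSq_eq_trace_mul_transpose {n m : ℕ} (M : Matrix (Fin n) (Fin m) ℝ) :
    matFrobSq M = Matrix.trace (M * Mᵀ) := by
  simp [matFrobSq, Matrix.trace, Matrix.mul_apply, sq]

theorem matFrobSq_eq_trace_transpose_mul {n m : ℕ} (M : Matrix (Fin n) (Fin m) ℝ) :
    matFrobSq M = Matrix.trace (Mᵀ * M) := by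
  rw [matFrobSq_eq_trace_mul_transpose, Matrix.trace_mul_comm]

theorem matFrobSq_mul_left {n m p : ℕ} (P : Matrix (Fin p) (Fin n) ℝ)
    (M : Matrix (Fin n) (Fin m) ℝ) :
    matFrobSq (P * M) = Matrix.trace (M * Mᵀ * (Pᵀ * P)) := by
  rw [matFrobSq_eq_trace_mul_transpose, Matrix.transpose_mul, Matrix.mul_assoc,
    Matrix.trace_mul_comm]
  simp only [Matrix.mul_assoc]

theorem matFrobSq_mul_right {n m p : ℕ} (M : Matrix (Fin n) (Fin m) ℝ)
    (P : Matrix (Fin m) (Fin p) ℝ) :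
    matFrobSq (M * P) = Matrix.trace (Mᵀ * M * (P * Pᵀ)) := by
  rw [matFrobSq_eq_trace_transpose_mul, Matrix.transpose_mul, Matrix.mul_assoc,
    Matrix.trace_mul_comm]
  simp only [Matrix.mul_assoc]

/-- (Sensitivity after rotation of two consecutive cores) Rotating the cores
`A` and `B` by an invertible matrix `Q` (i.e. `A i ↦ A i * Q`,
`B j ↦ Q⁻¹ * B j`) gives a representation whose sensitivity equals
`I₃ ∑_{i,j} ‖A i B j‖_F² + I₁ tr(T₁ (Q Qᵀ)⁻¹) + I₂ tr(T₂ (Q Qᵀ))`. -/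
theorem tc_sensitivity_after_rotation
    {I₁ I₂ I₃ R₁ R₂ R₃ : ℕ}
    (A : Fin I₁ → Matrix (Fin R₁) (Fin R₂) ℝ)
    (B : Fin I₂ → Matrix (Fin R₂) (Fin R₃) ℝ)
    (C : Fin I₃ → Matrix (Fin R₃) (Fin R₁) ℝ)
    (Q : Matrix (Fin R₂) (Fin R₂) ℝ) (hQ : IsUnit Q)
    (T₁ T₂ : Matrix (Fin R₂) (Fin R₂) ℝ)
    (hT₁ : T₁ = ∑ j, B j * (∑ k, C k * (C k)ᵀ) * (B j)ᵀ)
    (hT₂ : T₂ = ∑ i, (A i)ᵀ * (∑ k, (C k)ᵀ * C k) * A i) :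
    (I₁ : ℝ) * ∑ j, ∑ k, matFrobSq ((Q⁻¹ * B j) * C k) +
      (I₂ : ℝ) * ∑ k, ∑ i, matFrobSq (C k * (A i * Q)) +
      (I₃ : ℝ) * ∑ i, ∑ j, matFrobSq ((A i * Q) * (Q⁻¹ * B j)) =
    (I₃ : ℝ) * ∑ i, ∑ j, matFrobSq (A i * B j) +
      (I₁ : ℝ) * Matrix.trace (T₁ * (Q * Qᵀ)⁻¹) +
      (I₂ : ℝ) * Matrix.trace (T₂ * (Q * Qᵀ)) := by
  have hdet : IsUnit Q.det := (Matrix.isUnit_iff_isUnit_det Q).mp hQ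
  have hAB : ∀ i j, A i * Q * (Q⁻¹ * B j) = A i * B j := fun i j => by
    rw [Matrix.mul_assoc, Matrix.mul_nonsing_inv_cancel_left _ _ hdet]
  have hBC : ∑ j, ∑ k, matFrobSq (Q⁻¹ * B j * C k) = Matrix.trace (T₁ * (Q * Qᵀ)⁻¹) := by
    simp only [Matrix.mul_assoc Q⁻¹, matFrobSq_mul_left, hT₁, Matrix.mul_inv_rev,
      Matrix.transpose_nonsing_inv, Matrix.transpose_mul, Matrix.mul_sum, Matrix.sum_mul,
      Matrix.trace_sum, Matrix.mul_assoc]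
  have hCA : ∑ k, ∑ i, matFrobSq (C k * (A i * Q)) = Matrix.trace (T₂ * (Q * Qᵀ)) := by
    rw [Finset.sum_comm]
    simp only [← Matrix.mul_assoc (C _), matFrobSq_mul_right, hT₂, Matrix.transpose_mul,
      Matrix.mul_sum, Matrix.sum_mul, Matrix.trace_sum]
    simp only [Matrix.mul_assoc]
  simp only [hAB, hBC, hCA]
  ring
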